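/- arXiv:1008.0505 — 8 statements merged into one kernel-verified Lean document; each statement's English description precedes it below -/
import Mathlib

section
/- Let Q be a complex (M+E)×(M+E) unitary matrix written in block form Q = [[R, T_o],[T_i, Ũ]]. Then there exists at least one complex E×M matrix C such that (1 - Ũ) * C = T_i. -/
open Matrix in
/-- Fredholm alternative: over a field, `A * C = B` is solvable in `C` as soon as every row vector
annihilating `A` annihilates `B`. -/
theorem Matrix.exists_mul_eq_of_vecMul_eq_zero {K m n p : Type*} [Field K] [Fintype m]
    [Fintype n] [DecidableEq m] (A : Matrix m n K) (B : Matrix m p K)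
    (h : ∀ v : m → K, v ᵥ* A = 0 → v ᵥ* B = 0) :
    ∃ C : Matrix n p K, A * C = B := by
  have hmem : ∀ j, B.col j ∈ LinearMap.range A.mulVecLin := by
    intro j
    by_contra hj
    obtain ⟨f, hfj, hf⟩ := Submodule.exists_le_ker_of_notMem hj
    obtain ⟨v, rfl⟩ := (dotProductEquiv K m).surjective f
    refine hfj (congrFun (h v ?_) j)
    refine dotProduct_eq_zero _ fun w => ?_
    rw [← dotProduct_mulVec]
    exact hf ⟨w, rfl⟩
  choose c hc using hmem
  exact ⟨of fun i j => c j i, ext fun i j => congrFun (hc j) i⟩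

open Matrix ComplexOrder in
/-- If `B * Bᴴ + U * Uᴴ = 1`, then any row vector fixed by `U` is annihilated by `B`. -/
theorem Matrix.vecMul_eq_zero_of_vecMul_eq_self {m n : Type*} [Fintype m] [Fintype n]
    [DecidableEq m] {B : Matrix m n ℂ} {U : Matrix m m ℂ}
    (h : B * Bᴴ + U * Uᴴ = 1) {v : m → ℂ} (hv : v ᵥ* U = v) : v ᵥ* B = 0 := by
  have key := congrArg (fun A => v ᵥ* A ⬝ᵥ star v) h
  simp only [vecMul_add, add_dotProduct, ← vecMul_vecMul, vecMul_one] at key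
  simp only [← dotProduct_mulVec, ← star_vecMul, hv, add_eq_right] at key
  rw [dotProduct_mulVec] at key
  exact dotProduct_self_star_eq_zero.mp key

/-- Let `Q` be a complex `(M+E)×(M+E)` unitary matrix written in block
form `Q = [[R, T_o],[T_i, Ũ]]`.  Then there exists at least one complex `E×M` matrix `C`
such that `(1 - Ũ) * C = T_i`. -/
theorem exists_C_of_unitary_blocks (M E : ℕ)
    (R : Matrix (Fin M) (Fin M) ℂ) (To : Matrix (Fin M) (Fin E) ℂ)
    (Ti : Matrix (Fin E) (Fin M) ℂ) (U : Matrix (Fin E) (Fin E) ℂ)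
    (hQ : Matrix.fromBlocks R To Ti U ∈ Matrix.unitaryGroup (Fin M ⊕ Fin E) ℂ) :
    ∃ C : Matrix (Fin E) (Fin M) ℂ, (1 - U) * C = Ti := by
  rw [Matrix.mem_unitaryGroup_iff, Matrix.star_eq_conjTranspose, Matrix.fromBlocks_conjTranspose,
    Matrix.fromBlocks_multiply, ← Matrix.fromBlocks_one, Matrix.fromBlocks_inj] at hQ
  refine Matrix.exists_mul_eq_of_vecMul_eq_zero _ _ fun v hv => ?_
  rw [Matrix.vecMul_sub, Matrix.vecMul_one, sub_eq_zero] at hv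
  exact Matrix.vecMul_eq_zero_of_vecMul_eq_self hQ.2.2.2 hv.symm
end

section
/- Let Q be a complex (M+E)×(M+E) unitary matrix written in block form Q = [[R, T_o],[T_i, Ũ]]. If a vector v ∈ ℂ^E satisfies Ũᴴ v = v (i.e. v lies in the kernel of 1 - Ũᴴ, where Ũᴴ is the conjugate transpose of Ũ), then T_iᴴ v = 0. Equivalently, the range of T_i is contained in the range of 1 - Ũ. -/
open scoped Matrix

/-- Let `Q = [[R, T_o],[T_i, Ũ]]` be unitary.  If `Ũᴴ v = v`, then
`T_iᴴ v = 0`; equivalently, the range of `T_i` is contained in the range of `1 - Ũ`. -/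
theorem ker_one_sub_conjTranspose_subset (M E : ℕ)
    (R : Matrix (Fin M) (Fin M) ℂ) (To : Matrix (Fin M) (Fin E) ℂ)
    (Ti : Matrix (Fin E) (Fin M) ℂ) (U : Matrix (Fin E) (Fin E) ℂ)
    (hQ : Matrix.fromBlocks R To Ti U ∈ Matrix.unitaryGroup (Fin M ⊕ Fin E) ℂ)
    (v : Fin E → ℂ) (hv : Uᴴ.mulVec v = v) :
    Tiᴴ.mulVec v = 0 := by
  have hblock : Ti * Tiᴴ + U * Uᴴ = 1 := by
    have h := Matrix.mem_unitaryGroup_iff.mp hQ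
    rw [Matrix.star_eq_conjTranspose, Matrix.fromBlocks_conjTranspose,
      Matrix.fromBlocks_multiply, ← Matrix.fromBlocks_one] at h
    exact (Matrix.fromBlocks_inj.mp h).2.2.2
  have hnorm : ∀ {n : ℕ} (A : Matrix (Fin E) (Fin n) ℂ),
      star v ⬝ᵥ (A * Aᴴ) *ᵥ v = star (Aᴴ *ᵥ v) ⬝ᵥ Aᴴ *ᵥ v := fun A => by
    rw [Matrix.star_mulVec, Matrix.conjTranspose_conjTranspose, ← Matrix.mulVec_mulVec,
      Matrix.dotProduct_mulVec]
  have h := congrArg (fun A => star v ⬝ᵥ A *ᵥ v) hblock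
  simp only [Matrix.add_mulVec, dotProduct_add, hnorm, hv, Matrix.one_mulVec,
    add_eq_right] at h
  open scoped ComplexOrder in exact dotProduct_star_self_eq_zero.mp h
end

section
/- Let Q be a complex (M+E)×(M+E) unitary matrix written in block form Q = [[R, T_o],[T_i, Ũ]], and let C be any complex E×M matrix satisfying (1 - Ũ) * C = T_i. Then the M×M matrix S = R + T_o * C is unitary, i.e. Sᴴ * S = 1. -/
open scoped Matrix

/-- Let `Q = [[R, T_o],[T_i, Ũ]]` be unitary and let `C` satisfy
`(1 - Ũ) * C = T_i`.  Then `S = R + T_o * C` is unitary: `Sᴴ * S = 1`. -/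
theorem scattering_matrix_unitary (M E : ℕ)
    (R : Matrix (Fin M) (Fin M) ℂ) (To : Matrix (Fin M) (Fin E) ℂ)
    (Ti : Matrix (Fin E) (Fin M) ℂ) (U : Matrix (Fin E) (Fin E) ℂ)
    (hQ : Matrix.fromBlocks R To Ti U ∈ Matrix.unitaryGroup (Fin M ⊕ Fin E) ℂ)
    (C : Matrix (Fin E) (Fin M) ℂ) (hC : (1 - U) * C = Ti) :
    (R + To * C)ᴴ * (R + To * C) = 1 := by
  have hrows : Matrix.fromBlocks R To Ti U *
      Matrix.fromRows (1 : Matrix (Fin M) (Fin M) ℂ) C =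
      Matrix.fromRows (R + To * C) C := by
    rw [Matrix.fromBlocks_mul_fromRows, ← hC, Matrix.sub_mul]
    simp
  have hgram : (Matrix.fromRows (R + To * C) C)ᴴ * Matrix.fromRows (R + To * C) C =
      (Matrix.fromRows (1 : Matrix (Fin M) (Fin M) ℂ) C)ᴴ *
        Matrix.fromRows (1 : Matrix (Fin M) (Fin M) ℂ) C := by
    have hunit := Matrix.mem_unitaryGroup_iff'.mp hQ
    rw [Matrix.star_eq_conjTranspose] at hunit
    rw [← hrows, Matrix.conjTranspose_mul, Matrix.mul_assoc,
      ← Matrix.mul_assoc (Matrix.fromBlocks R To Ti U)ᴴ, hunit, Matrix.one_mul]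
  simpa only [Matrix.conjTranspose_fromRows_eq_fromCols_conjTranspose,
    Matrix.fromCols_mul_fromRows, Matrix.conjTranspose_one, Matrix.one_mul,
    add_left_inj] using hgram
end

section
/- Let Q be a complex (M+E)×(M+E) unitary matrix written in block form Q = [[R, T_o],[T_i, Ũ]], and let C₁ and C₂ be two complex E×M matrices each satisfying (1 - Ũ) * Cⱼ = T_i (j = 1,2). Then R + T_o * C₁ = R + T_o * C₂; that is, the matrix S = R + T_o * C does not depend on the particular choice of solution C. -/
open scoped ComplexOrder in
open Matrix in
/-- If the columns of `[T; U]` are orthonormal, then `T` annihilates every fixed point of `U`. -/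
theorem Matrix.mul_eq_zero_of_mul_eq_self {m n k : Type*} [Fintype m] [Fintype n]
    [DecidableEq n] {T : Matrix m n ℂ} {U : Matrix n n ℂ} {D : Matrix n k ℂ}
    (h : Tᴴ * T + Uᴴ * U = 1) (hD : U * D = D) : T * D = 0 := by
  have key : (T * D)ᴴ * (T * D) + (U * D)ᴴ * (U * D) = Dᴴ * D := by
    calc _ = Dᴴ * (Tᴴ * T + Uᴴ * U) * D := by
          simp only [conjTranspose_mul, Matrix.mul_add, Matrix.add_mul, Matrix.mul_assoc]
      _ = Dᴴ * D := by rw [h, Matrix.mul_one]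
  rw [hD, add_eq_right] at key
  exact conjTranspose_mul_self_eq_zero.mp key

/-- Let `Q = [[R, T_o],[T_i, Ũ]]` be unitary and let `C₁`, `C₂` both
satisfy `(1 - Ũ) * Cⱼ = T_i`.  Then `R + T_o * C₁ = R + T_o * C₂`: the scattering matrix
`S = R + T_o * C` does not depend on the choice of the solution `C`. -/
theorem scattering_matrix_well_defined (M E : ℕ)
    (R : Matrix (Fin M) (Fin M) ℂ) (To : Matrix (Fin M) (Fin E) ℂ)
    (Ti : Matrix (Fin E) (Fin M) ℂ) (U : Matrix (Fin E) (Fin E) ℂ)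
    (hQ : Matrix.fromBlocks R To Ti U ∈ Matrix.unitaryGroup (Fin M ⊕ Fin E) ℂ)
    (C₁ C₂ : Matrix (Fin E) (Fin M) ℂ)
    (hC₁ : (1 - U) * C₁ = Ti) (hC₂ : (1 - U) * C₂ = Ti) :
    R + To * C₁ = R + To * C₂ := by
  have hcol : To.conjTranspose * To + U.conjTranspose * U = 1 := by
    have h := Matrix.mem_unitaryGroup_iff'.mp hQ
    rw [Matrix.star_eq_conjTranspose, Matrix.fromBlocks_conjTranspose,
      Matrix.fromBlocks_multiply, ← Matrix.fromBlocks_one] at h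
    exact (Matrix.fromBlocks_inj.mp h).2.2.2
  have hfix : U * (C₁ - C₂) = C₁ - C₂ := by
    have h : (1 - U) * (C₁ - C₂) = 0 := by rw [Matrix.mul_sub, hC₁, hC₂, sub_self]
    rw [Matrix.sub_mul, Matrix.one_mul, sub_eq_zero] at h
    exact h.symm
  have h := Matrix.mul_eq_zero_of_mul_eq_self hcol hfix
  rw [Matrix.mul_sub, sub_eq_zero] at h
  rw [h]
end

section
/- Let Q be a complex (M+E)×(M+E) unitary matrix written in block form Q = [[R, T_o],[T_i, Ũ]], let C be a complex E×M matrix satisfying (1 - Ũ) * C = T_i, and set S = R + T_o * C. Then for every vector c_in ∈ ℂ^M, a pair of vectors (c_out, a) ∈ ℂ^M × ℂ^E satisfies the linear system c_out = R.mulVec c_in + T_o.mulVec a and a = T_i.mulVec c_in + Ũ.mulVec a if and only if c_out = S.mulVec c_in and a - C.mulVec c_in lies in the kernel of 1 - Ũ. In particular c_out is uniquely determined by c_in. -/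
open scoped ComplexOrder in
/-- A fixed vector of the lower right block of a unitary block matrix is annihilated by the
upper right block. -/
theorem Matrix.mulVec_eq_zero_of_fromBlocks_mem_unitaryGroup {m n : Type*} [Fintype m] [Fintype n]
    [DecidableEq m] [DecidableEq n] {A : Matrix m m ℂ} {B : Matrix m n ℂ} {C : Matrix n m ℂ}
    {D : Matrix n n ℂ} (hQ : Matrix.fromBlocks A B C D ∈ Matrix.unitaryGroup (m ⊕ n) ℂ)
    {v : n → ℂ} (hv : D.mulVec v = v) : B.mulVec v = 0 := by
  have hcol : B.conjTranspose * B + D.conjTranspose * D = 1 := by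
    have h := Matrix.mem_unitaryGroup_iff'.mp hQ
    rw [Matrix.star_eq_conjTranspose, Matrix.fromBlocks_conjTranspose,
      Matrix.fromBlocks_multiply, ← Matrix.fromBlocks_one, Matrix.fromBlocks_inj] at h
    exact h.2.2.2
  have hnorm : star (B.mulVec v) ⬝ᵥ B.mulVec v + star (D.mulVec v) ⬝ᵥ D.mulVec v =
      star v ⬝ᵥ v := by
    simp only [Matrix.star_mulVec, ← Matrix.dotProduct_mulVec, Matrix.mulVec_mulVec,
      ← dotProduct_add, ← Matrix.add_mulVec, hcol, Matrix.one_mulVec]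
  rw [hv, add_eq_right] at hnorm
  exact dotProduct_star_self_eq_zero.mp hnorm

/-- Let `Q = [[R, T_o],[T_i, Ũ]]` be unitary, let `C` satisfy
`(1 - Ũ) * C = T_i` and set `S = R + T_o * C`.  Then for every `c_in`, a pair
`(c_out, a)` solves the linear system `c_out = R c_in + T_o a`, `a = T_i c_in + Ũ a`
if and only if `c_out = S c_in` and `a - C c_in ∈ Ker (1 - Ũ)`.  In particular
`c_out` is uniquely determined by `c_in`. -/
theorem scattering_solutions (M E : ℕ)
    (R : Matrix (Fin M) (Fin M) ℂ) (To : Matrix (Fin M) (Fin E) ℂ)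
    (Ti : Matrix (Fin E) (Fin M) ℂ) (U : Matrix (Fin E) (Fin E) ℂ)
    (hQ : Matrix.fromBlocks R To Ti U ∈ Matrix.unitaryGroup (Fin M ⊕ Fin E) ℂ)
    (C : Matrix (Fin E) (Fin M) ℂ) (hC : (1 - U) * C = Ti)
    (c_in : Fin M → ℂ) (c_out : Fin M → ℂ) (a : Fin E → ℂ) :
    (c_out = R.mulVec c_in + To.mulVec a ∧ a = Ti.mulVec c_in + U.mulVec a) ↔
      (c_out = (R + To * C).mulVec c_in ∧
        (1 - U).mulVec (a - C.mulVec c_in) = 0) := by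
  have hfix : a = Ti.mulVec c_in + U.mulVec a ↔ (1 - U).mulVec (a - C.mulVec c_in) = 0 := by
    rw [Matrix.mulVec_sub, Matrix.mulVec_mulVec, hC, Matrix.sub_mulVec, Matrix.one_mulVec,
      sub_eq_zero, sub_eq_iff_eq_add]
  rw [hfix]
  refine and_congr_left fun hker => ?_
  have hTo : To.mulVec (a - C.mulVec c_in) = 0 := by
    refine Matrix.mulVec_eq_zero_of_fromBlocks_mem_unitaryGroup hQ ?_
    rw [Matrix.sub_mulVec, Matrix.one_mulVec, sub_eq_zero] at hker
    exact hker.symm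
  rw [Matrix.mulVec_sub, sub_eq_zero] at hTo
  rw [Matrix.add_mulVec, ← Matrix.mulVec_mulVec, hTo]
end

section
/- Let n be a natural number and let S : ℝ → Matrix(n,n,ℂ), v : ℝ → ℂⁿ and φ : ℝ → ℝ be differentiable functions such that for every k ∈ ℝ: S(k) is unitary, the vector v(k) is normalized (star v(k) ⬝ᵥ v(k) = 1), and S(k).mulVec v(k) = e^{iφ(k)} • v(k). Then for every k ∈ ℝ, star v(k) ⬝ᵥ (S(k)ᴴ * S'(k)).mulVec v(k) = i · φ'(k), where S'(k) and φ'(k) denote the derivatives with respect to k. -/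
open scoped Matrix

/-- Product rule for a matrix-valued function applied to a vector-valued function, with
derivatives taken entrywise. -/
theorem hasDerivAt_mulVec_apply {m n : Type*} [Fintype n]
    {S : ℝ → Matrix m n ℂ} {S' : Matrix m n ℂ} {v : ℝ → n → ℂ} {v' : n → ℂ} {k : ℝ}
    (hS : ∀ i j, HasDerivAt (fun k => S k i j) (S' i j) k)
    (hv : ∀ j, HasDerivAt (fun k => v k j) (v' j) k) (i : m) :
    HasDerivAt (fun k => (S k *ᵥ v k) i) ((S' *ᵥ v k + S k *ᵥ v') i) k := by
  simp only [Pi.add_apply, Matrix.mulVec, dotProduct, ← Finset.sum_add_distrib]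
  exact HasDerivAt.fun_sum fun j _ => (hS i j).fun_mul (hv j)

/-- If `S v = e • v`, then pairing `Sᴴ w` with `v` multiplies the pairing of `w` with `v`
by the conjugate of `e`. -/
theorem star_dotProduct_conjTranspose_mulVec {n : Type*} [Fintype n]
    {S : Matrix n n ℂ} {v : n → ℂ} {e : ℂ} (h : S *ᵥ v = e • v) (w : n → ℂ) :
    star v ⬝ᵥ Sᴴ *ᵥ w = star e * (star v ⬝ᵥ w) := by
  rw [Matrix.dotProduct_mulVec, ← Matrix.star_mulVec, h, star_smul, smul_dotProduct, smul_eq_mul]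

/-- Let `S : ℝ → Matrix (Fin n) (Fin n) ℂ`, `v : ℝ → ℂⁿ` and
`φ : ℝ → ℝ` be differentiable (entrywise, with derivatives `S'`, `v'`, `φ'`) and
suppose that for every `k`: `S k` is unitary, `v k` is normalized and
`S k * v k = e^{i φ k} • v k`.  Then for every `k`,
`star (v k) ⬝ᵥ ((S k)ᴴ * S' k) (v k) = i * φ' k`. -/
theorem phase_derivative_formula (n : ℕ)
    (S S' : ℝ → Matrix (Fin n) (Fin n) ℂ) (v v' : ℝ → (Fin n → ℂ))
    (φ φ' : ℝ → ℝ)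
    (hS : ∀ i j k, HasDerivAt (fun k => S k i j) (S' k i j) k)
    (hv : ∀ i k, HasDerivAt (fun k => v k i) (v' k i) k)
    (hφ : ∀ k, HasDerivAt φ (φ' k) k)
    (hunit : ∀ k, S k ∈ Matrix.unitaryGroup (Fin n) ℂ)
    (hnorm : ∀ k, star (v k) ⬝ᵥ v k = 1)
    (heig : ∀ k, (S k).mulVec (v k) = Complex.exp (Complex.I * φ k) • v k) :
    ∀ k, star (v k) ⬝ᵥ ((S k)ᴴ * S' k).mulVec (v k) = Complex.I * φ' k := by
  intro k
  set e := Complex.exp (Complex.I * φ k) with he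
  have hexp : HasDerivAt (fun k => Complex.exp (Complex.I * φ k)) (e * (Complex.I * φ' k)) k :=
    ((hφ k).ofReal_comp.const_mul Complex.I).cexp
  have hderiv : S' k *ᵥ v k + S k *ᵥ v' k = (e * (Complex.I * φ' k)) • v k + e • v' k := by
    funext i
    have hright := hexp.fun_mul (hv i k)
    have hleft := hasDerivAt_mulVec_apply (fun i j => hS i j k) (fun j => hv j k) i
    simp only [heig, Pi.smul_apply, smul_eq_mul] at hleft
    exact hleft.unique hright
  have hunimod : star e * e = 1 := by
    rw [he, Complex.star_def, ← Complex.exp_conj, ← Complex.exp_add]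
    simp
  have hcancel : star e * (star (v k) ⬝ᵥ S k *ᵥ v' k) = star (v k) ⬝ᵥ v' k := by
    rw [← star_dotProduct_conjTranspose_mulVec (heig k), Matrix.mulVec_mulVec,
      ← Matrix.star_eq_conjTranspose, Matrix.mem_unitaryGroup_iff'.mp (hunit k), Matrix.one_mulVec]
  rw [← Matrix.mulVec_mulVec, star_dotProduct_conjTranspose_mulVec (heig k),
    eq_sub_of_add_eq hderiv, dotProduct_sub, dotProduct_add, dotProduct_smul, dotProduct_smul,
    hnorm, smul_eq_mul, smul_eq_mul, ← he]
  linear_combination (Complex.I * φ' k + star (v k) ⬝ᵥ v' k) * hunimod - hcancel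
end

section
/- Let S be a 2×2 complex unitary matrix with S₁₂ = S₂₁, and let φ ∈ ℝ be such that det(S) = e^{2iφ}. Set ζ = det(1 - S) and τ = S₁₂. Then there exist real numbers r and t such that ζ = r·e^{iφ} and τ = (i/2)·t·e^{iφ}, and moreover for every ε ∈ ℝ, det((1 - ε·σ₁) - S) = (r - i·ε·t)·e^{iφ} - ε², where σ₁ = [[0,1],[1,0]] is the first Pauli matrix and 1 the 2×2 identity matrix. -/
open scoped ComplexConjugate

/-- The adjugate of a unitary matrix is its determinant times its conjugate transpose. -/
theorem Matrix.adjugate_eq_det_smul_star_of_mem_unitaryGroup {n R : Type*} [Fintype n]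
    [DecidableEq n] [CommRing R] [StarRing R] {U : Matrix n n R}
    (hU : U ∈ Matrix.unitaryGroup n R) : U.adjugate = U.det • star U := by
  calc U.adjugate = U.adjugate * (U * star U) := by
        rw [Matrix.mem_unitaryGroup_iff.mp hU, mul_one]
    _ = U.det • star U := by
        rw [← mul_assoc, Matrix.adjugate_mul, smul_mul_assoc, one_mul]

/-- The fixed points of `z ↦ e^{2iφ} * conj z` are the real multiples of `e^{iφ}`. -/
theorem Complex.exists_eq_ofReal_mul_exp_of_exp_mul_conj_eq {z : ℂ} {φ : ℝ}
    (h : exp (2 * I * φ) * conj z = z) : ∃ r : ℝ, z = r * exp (I * φ) := by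
  have hsq : exp (2 * I * φ) = exp (I * φ) * exp (I * φ) := by
    rw [← exp_add]; ring_nf
  have hconj : conj (exp (I * φ)) = exp (-(I * φ)) := by
    rw [← exp_conj]; simp
  have hinv : exp (I * φ) * exp (-(I * φ)) = 1 := by
    rw [← exp_add, add_neg_cancel, exp_zero]
  have hreal : conj (z * exp (-(I * φ))) = z * exp (-(I * φ)) := by
    rw [← hconj, map_mul, conj_conj, hconj]
    rw [hsq] at h
    linear_combination exp (-(I * φ)) * h - conj z * exp (I * φ) * hinv
  obtain ⟨r, hr⟩ := conj_eq_iff_real.mp hreal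
  exact ⟨r, by linear_combination exp (I * φ) * hr - z * hinv⟩

/-- Let `S` be a `2×2` complex unitary matrix with `S₁₂ = S₂₁`, and
let `φ ∈ ℝ` satisfy `det S = e^{2iφ}`.  Set `ζ = det (1 - S)` and `τ = S₁₂`.  Then
there are real `r`, `t` with `ζ = r e^{iφ}`, `τ = (i/2) t e^{iφ}`, and for every
`ε ∈ ℝ`, `det ((1 - ε σ₁) - S) = (r - i ε t) e^{iφ} - ε²`, where `σ₁ = [[0,1],[1,0]]`. -/
theorem det_Id_eps_sub_S_formula (S : Matrix (Fin 2) (Fin 2) ℂ)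
    (hS : S ∈ Matrix.unitaryGroup (Fin 2) ℂ) (hsym : S 0 1 = S 1 0)
    (φ : ℝ) (hφ : S.det = Complex.exp (2 * Complex.I * φ)) :
    ∃ r t : ℝ,
      (1 - S).det = r * Complex.exp (Complex.I * φ) ∧
      S 0 1 = Complex.I / 2 * t * Complex.exp (Complex.I * φ) ∧
      ∀ ε : ℝ,
        ((1 - (ε : ℂ) • !![(0 : ℂ), 1; 1, 0]) - S).det =
          (r - Complex.I * ε * t) * Complex.exp (Complex.I * φ) - ε ^ 2 := by
  have hadj := Matrix.adjugate_eq_det_smul_star_of_mem_unitaryGroup hS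
  rw [hφ, Matrix.adjugate_fin_two] at hadj
  have h00 : S 1 1 = Complex.exp (2 * Complex.I * φ) * conj (S 0 0) := by
    simpa using congr_fun₂ hadj 0 0
  have h01 : -S 0 1 = Complex.exp (2 * Complex.I * φ) * conj (S 1 0) := by
    simpa using congr_fun₂ hadj 0 1
  have h11 : S 0 0 = Complex.exp (2 * Complex.I * φ) * conj (S 1 1) := by
    simpa using congr_fun₂ hadj 1 1
  have hζ : (1 - S).det = 1 - S 0 0 - S 1 1 + S.det := by
    simp [Matrix.det_fin_two]; ring
  have hunit : Complex.exp (2 * Complex.I * φ) * conj (Complex.exp (2 * Complex.I * φ)) = 1 := by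
    rw [← Complex.exp_conj, ← Complex.exp_add]
    simp [map_ofNat]
  obtain ⟨r, hr⟩ : ∃ r : ℝ, (1 - S).det = r * Complex.exp (Complex.I * φ) := by
    apply Complex.exists_eq_ofReal_mul_exp_of_exp_mul_conj_eq
    rw [hζ, hφ]
    simp only [map_add, map_sub, map_one]
    linear_combination h00 + h11 + hunit
  obtain ⟨t, ht⟩ : ∃ t : ℝ, -2 * Complex.I * S 0 1 = t * Complex.exp (Complex.I * φ) := by
    apply Complex.exists_eq_ofReal_mul_exp_of_exp_mul_conj_eq
    rw [← hsym] at h01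
    simp only [map_mul, map_neg, map_ofNat, Complex.conj_I]
    linear_combination -2 * Complex.I * h01
  have hτ : S 0 1 = Complex.I / 2 * t * Complex.exp (Complex.I * φ) := by
    linear_combination Complex.I / 2 * ht + S 0 1 * Complex.I_sq
  refine ⟨r, t, hr, hτ, fun ε => ?_⟩
  have hdet : ((1 - (ε : ℂ) • !![(0 : ℂ), 1; 1, 0]) - S).det =
      (1 - S).det - 2 * ε * S 0 1 - ε ^ 2 := by
    simp [Matrix.det_fin_two, ← hsym]; ring
  rw [hdet]
  linear_combination hr - 2 * ε * hτ
end

section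
/- Let a, b, c be positive real numbers such that a/(b+c) is irrational, and let n and p be natural numbers with n ≥ 1. If ⌊(a/(b+c))·p⌋ + p < n and n ≤ ⌊(a/(b+c))·(p+1)⌋ + (p+1), then p = ⌊((b+c)/(a+b+c))·n⌋. -/
/-- Let `a, b, c > 0` with `a/(b+c)` irrational and let `n ≥ 1`, `p`
be natural numbers.  If `⌊(a/(b+c))p⌋ + p < n ≤ ⌊(a/(b+c))(p+1)⌋ + (p+1)`, then
`p = ⌊((b+c)/(a+b+c))n⌋`. -/
theorem merge_split_count_formula (a b c : ℝ) (ha : 0 < a) (hb : 0 < b) (hc : 0 < c)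
    (hirr : Irrational (a / (b + c))) (n p : ℕ) (hn : 1 ≤ n)
    (h1 : ⌊a / (b + c) * p⌋ + (p : ℤ) < (n : ℤ))
    (h2 : (n : ℤ) ≤ ⌊a / (b + c) * (p + 1)⌋ + ((p : ℤ) + 1)) :
    (p : ℤ) = ⌊(b + c) / (a + b + c) * n⌋ := by
  have hbc : 0 < b + c := add_pos hb hc
  have hquot : (b + c) / (a + b + c) * n = n / (a / (b + c) + 1) := by
    field_simp
    ring
  have hr : 0 < a / (b + c) := div_pos ha hbc
  rw [hquot]
  generalize a / (b + c) = r at *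
  have lower : r * p < ((n - p : ℤ) : ℝ) := Int.floor_lt.mp (by omega)
  have upper : ((n - (p + 1) : ℤ) : ℝ) ≤ r * (p + 1) := Int.le_floor.mp (by omega)
  have upper_ne : ((n - (p + 1) : ℤ) : ℝ) ≠ r * (p + 1) := by
    have h := (hirr.mul_natCast p.succ_ne_zero).ne_int (n - (p + 1))
    push_cast at h ⊢
    exact h.symm
  have upper_lt := lt_of_le_of_ne upper upper_ne
  push_cast at lower upper_lt
  symm
  rw [Int.floor_eq_iff, le_div_iff₀ (by positivity), div_lt_iff₀ (by positivity)]
  push_cast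
  constructor <;> linarith
end
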